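/- Let k = 4 and n ≥ 8, and let h be defined by the following cases: h = 2^s − 1 if n = 2^s + 1 with s ≥ 3; h = 2^{s+1} − 4 if n = 2^s + 2 with s ≥ 3; h = 2^{s+1} − 4 if n = 2^s + 3 with s ≥ 3; h = 2^{s+1} − 1 if 2^s + 4 ≤ n ≤ 2^{s+1}. Then the height of w_2 modulo I_{n,4} equals h, i.e. w_2^h ∉ I_{n,4} and w_2^{h+1} ∈ I_{n,4} in (ZMod 2)[w_1, w_2, w_3, w_4]. (Lemma F, the Dutta–Khare computation of ht(w_2(γ_{n,4})) in H*(G_{n,4}; Z2), translated via Borel's description of the cohomology ring.) -/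

import Mathlib

open MvPolynomial

/-- Borel's ideal `I_{n,k}`: the ideal of `(ZMod 2)[w₁, …, w_k]` (with `w_i = X (i−1)` of
weight `i`) generated by the weighted-homogeneous components of weighted degrees
`n−k+1, …, n` of `Σ_{j=0}^{n} (w₁ + ⋯ + w_k)^j`, the formal inverse of `1 + w₁ + ⋯ + w_k`.
One has `(ZMod 2)[w₁, …, w_k]/I_{n,k} ≅ H*(G_{n,k}; Z₂)`. -/
noncomputable def borelIdeal (n k : ℕ) : Ideal (MvPolynomial (Fin k) (ZMod 2)) :=
  Ideal.span { p | ∃ d ∈ Finset.Icc (n - k + 1) n,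
    p = weightedHomogeneousComponent (fun i : Fin k => (i : ℕ) + 1) d
          (∑ j ∈ Finset.range (n + 1), (∑ i : Fin k, X i) ^ j) }


def gg {R : Type*} [CommRing R] (w : Fin 4 → R) : ℕ → R
  | 0 => 0
  | 1 => 0
  | 2 => 0
  | 3 => 1
  | (m+4) => w 0 * gg w (m+3) + w 1 * gg w (m+2) + w 2 * gg w (m+1) + w 3 * gg w m

lemma gg_map {R S : Type*} [CommRing R] [CommRing S] (f : R →+* S) (w : Fin 4 → R) :
    ∀ m, f (gg w m) = gg (fun i => f (w i)) m
  | 0 => by simp [gg]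
  | 1 => by simp [gg]
  | 2 => by simp [gg]
  | 3 => by simp [gg]
  | (m+4) => by
    simp [gg, gg_map f w (m+3), gg_map f w (m+2), gg_map f w (m+1), gg_map f w m]

abbrev PP := MvPolynomial (Fin 4) (ZMod 2)

lemma comp_X_mul (i : Fin 4) (p : PP) (d : ℕ) :
    weightedHomogeneousComponent (fun i : Fin 4 => (i : ℕ) + 1) d (X i * p) =
      if (i : ℕ) + 1 ≤ d then
        X i * weightedHomogeneousComponent (fun i : Fin 4 => (i : ℕ) + 1) (d - (i + 1)) p
      else 0 := by
  ext m
  have key : ∀ m : Fin 4 →₀ ℕ, i ∈ m.support →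
      Finsupp.weight (fun i : Fin 4 => (i : ℕ) + 1) m =
      Finsupp.weight (fun i : Fin 4 => (i : ℕ) + 1) (m - Finsupp.single i 1) + (i + 1) := by
    intro m hm
    have h1 : m = (m - Finsupp.single i 1) + Finsupp.single i 1 := by
      rw [tsub_add_cancel_of_le]
      simp only [Finsupp.single_le_iff]
      have := Finsupp.mem_support_iff.mp hm
      omega
    conv_lhs => rw [h1]
    rw [map_add, Finsupp.weight_single]
    simp
  rw [coeff_weightedHomogeneousComponent, coeff_X_mul']
  by_cases hm : i ∈ m.support
  · have := key m hm
    by_cases hd : (i : ℕ) + 1 ≤ d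
    · rw [if_pos hd, coeff_X_mul', coeff_weightedHomogeneousComponent, if_pos hm, if_pos hm]
      congr 1
      apply propext
      omega
    · rw [if_neg hd, if_neg (by omega)]; simp
  · by_cases hd : (i : ℕ) + 1 ≤ d
    · rw [if_pos hd, coeff_X_mul', if_neg hm, if_neg hm]; simp
    · rw [if_neg hd, if_neg hm]; simp

lemma comp_u_pow (k : ℕ) : ∀ d, d < k →
    weightedHomogeneousComponent (fun i : Fin 4 => (i : ℕ) + 1) d ((∑ i : Fin 4, X i : PP) ^ k)
      = 0 := by
  induction k with
  | zero => intro d hd; omega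
  | succ k ih =>
    intro d hd
    rw [pow_succ', Finset.sum_mul, map_sum]
    apply Finset.sum_eq_zero
    intro i _
    rw [comp_X_mul]
    split_ifs with h
    · rw [ih _ (by omega), mul_zero]
    · rfl

lemma comp_gg (n : ℕ) : ∀ d, d ≤ n →
    weightedHomogeneousComponent (fun i : Fin 4 => (i : ℕ) + 1) d
      (∑ j ∈ Finset.range (n + 1), (∑ i : Fin 4, X i : PP) ^ j) = gg X (d + 3) := by
  set S : PP := ∑ j ∈ Finset.range (n + 1), (∑ i : Fin 4, X i : PP) ^ j with hS
  have hrec : S = 1 + (∑ i : Fin 4, X i * S) - (∑ i : Fin 4, X i : PP) ^ (n+1) := by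
    rw [← Finset.sum_mul]
    have := geom_sum_mul (∑ i : Fin 4, X i : PP) (n+1)
    rw [← hS] at this
    linear_combination - this
  intro d
  induction d using Nat.strong_induction_on with
  | _ d ih =>
  intro hd
  rw [hrec, map_sub, map_add, map_sum, comp_u_pow _ _ (by omega), sub_zero]
  simp only [comp_X_mul, Fin.sum_univ_four]
  have h1 : weightedHomogeneousComponent (fun i : Fin 4 => (i : ℕ) + 1) d (1 : PP) =
      if d = 0 then 1 else 0 := by
    ext m
    rw [coeff_weightedHomogeneousComponent, coeff_one]
    by_cases hm : 0 = m
    · subst hm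
      by_cases h0 : d = 0
      · simp [h0]
      · have : ¬ (0 = d) := fun h => h0 h.symm
        simp [h0, this]
    · by_cases h0 : d = 0 <;> simp [h0, hm, coeff_one]
  rw [h1]
  match d with
  | 0 => simp [gg]
  | 1 =>
    have e0 := ih 0 (by omega) (by omega)
    simp [gg] at e0 ⊢
    simp [e0]
  | 2 =>
    have e0 := ih 0 (by omega) (by omega)
    have e1 := ih 1 (by omega) (by omega)
    simp [gg] at e0 e1 ⊢
    simp [e0, e1]
  | 3 =>
    have e0 := ih 0 (by omega) (by omega)
    have e1 := ih 1 (by omega) (by omega)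
    have e2 := ih 2 (by omega) (by omega)
    simp [gg] at e0 e1 e2 ⊢
    simp [e0, e1, e2]
  | (d+4) =>
    have e3 := ih (d+3) (by omega) (by omega)
    have e2 := ih (d+2) (by omega) (by omega)
    have e1 := ih (d+1) (by omega) (by omega)
    have e0 := ih d (by omega) (by omega)
    have : d + 4 + 3 = (d + 3) + 4 := by omega
    rw [this, gg]
    simp [e3, e2, e1, e0]

lemma borel_eq (n : ℕ) (hn : 4 ≤ n) :
    borelIdeal n 4 = Ideal.span {p | ∃ j < 4, p = gg X (n + j)} := by
  unfold borelIdeal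
  congr 1
  ext p
  constructor
  · rintro ⟨d, hd, rfl⟩
    rw [Finset.mem_Icc] at hd
    refine ⟨d + 3 - n, by omega, ?_⟩
    rw [comp_gg n d hd.2]
    congr 1; omega
  · rintro ⟨j, hj, rfl⟩
    refine ⟨n + j - 3, Finset.mem_Icc.mpr (by omega), ?_⟩
    rw [comp_gg n _ (by omega)]
    congr 1; omega

/-! Upper bounds -/

def det4 {R : Type*} [CommRing R] (a b c d : Fin 4 → R) : R :=
    (a 0 * b 1 - a 1 * b 0) * (c 2 * d 3 - c 3 * d 2)
    - (a 0 * b 2 - a 2 * b 0) * (c 1 * d 3 - c 3 * d 1)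
    + (a 0 * b 3 - a 3 * b 0) * (c 1 * d 2 - c 2 * d 1)
    + (a 1 * b 2 - a 2 * b 1) * (c 0 * d 3 - c 3 * d 0)
    - (a 1 * b 3 - a 3 * b 1) * (c 0 * d 2 - c 2 * d 0)
    + (a 2 * b 3 - a 3 * b 2) * (c 0 * d 1 - c 1 * d 0)

lemma det4_eq {R : Type*} [CommRing R] (a b c d : Fin 4 → R) : det4 a b c d =
    (a 0 * b 1 - a 1 * b 0) * (c 2 * d 3 - c 3 * d 2)
    - (a 0 * b 2 - a 2 * b 0) * (c 1 * d 3 - c 3 * d 1)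
    + (a 0 * b 3 - a 3 * b 0) * (c 1 * d 2 - c 2 * d 1)
    + (a 1 * b 2 - a 2 * b 1) * (c 0 * d 3 - c 3 * d 0)
    - (a 1 * b 3 - a 3 * b 1) * (c 0 * d 2 - c 2 * d 0)
    + (a 2 * b 3 - a 3 * b 2) * (c 0 * d 1 - c 1 * d 0) := rfl

def uu {R : Type*} [CommRing R] (w : Fin 4 → R) (m : ℕ) : Fin 4 → R := fun j => gg w (m + j)

def DD {R : Type*} [CommRing R] (w : Fin 4 → R) (a b c d : ℕ) : R :=
  det4 (uu w a) (uu w b) (uu w c) (uu w d)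

lemma DD_step {R : Type*} [CommRing R] (w : Fin 4 → R) (a b c d : ℕ) :
    - w 1 * DD w a b c d = DD w (a+1) (b+1) c d + DD w (a+1) b (c+1) d + DD w (a+1) b c (d+1)
      + DD w a (b+1) (c+1) d + DD w a (b+1) c (d+1) + DD w a b (c+1) (d+1) := by
  have h0 : ∀ m, uu w (m+1) 0 = uu w m 1 := fun m => by simp [uu]
  have h1 : ∀ m, uu w (m+1) 1 = uu w m 2 := fun m => by simp [uu, add_assoc]
  have h2 : ∀ m, uu w (m+1) 2 = uu w m 3 := fun m => by simp [uu, add_assoc]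
  have h3 : ∀ m, uu w (m+1) 3 = w 0 * uu w m 3 + w 1 * uu w m 2 + w 2 * uu w m 1
      + w 3 * uu w m 0 := fun m => by
    simp only [uu]
    have : m + 1 + ((3 : Fin 4) : ℕ) = m + 4 := by simp
    rw [this, gg]; simp
  simp only [DD, det4_eq, h0, h1, h2, h3]
  ring

lemma DD_base {R : Type*} [CommRing R] (w : Fin 4 → R) : DD w 3 2 1 0 = 1 := by
  simp [DD, det4_eq, uu, gg]

section
variable {R : Type*} [CommRing R] (w : Fin 4 → R) (a b c d : ℕ)
lemma DD_12 : DD w a a c d = 0 := by simp only [DD, det4_eq]; ring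
lemma DD_23 : DD w a b b d = 0 := by simp only [DD, det4_eq]; ring
lemma DD_34 : DD w a b c c = 0 := by simp only [DD, det4_eq]; ring
lemma DD_14 : DD w a b c a = 0 := by simp only [DD, det4_eq]; ring
end

lemma DD_frob {R : Type*} [CommRing R] [CharP R 2] (w : Fin 4 → R) (k : ℕ) : ∀ a b c d,
    w 1 ^ (2 ^ k) * DD w a b c d =
      DD w (a+2^k) (b+2^k) c d + DD w (a+2^k) b (c+2^k) d + DD w (a+2^k) b c (d+2^k)
      + DD w a (b+2^k) (c+2^k) d + DD w a (b+2^k) c (d+2^k) + DD w a b (c+2^k) (d+2^k) := by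
  induction k with
  | zero =>
    intro a b c d
    have h2 : (2 : R) = 0 := CharTwo.two_eq_zero
    have := DD_step w a b c d
    simp only [pow_zero, pow_one]
    linear_combination this + w 1 * DD w a b c d * h2
  | succ k ih =>
    intro a b c d
    have h2 : (2 : R) = 0 := CharTwo.two_eq_zero
    have e : ∀ x : ℕ, x + 2 ^ (k+1) = x + 2 ^ k + 2 ^ k := fun x => by ring
    simp only [e]
    have : w 1 ^ 2 ^ (k+1) = w 1 ^ 2 ^ k * w 1 ^ 2 ^ k := by rw [← pow_add]; congr 1; ring
    rw [this, mul_assoc]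
    generalize w 1 ^ 2 ^ k = v at *
    generalize 2 ^ k = t at *
    simp only [ih, mul_add]
    linear_combination (DD w (a+t+t) (b+t) (c+t) d
      + DD w (a+t+t) (b+t) c (d+t)
      + DD w (a+t+t) b (c+t) (d+t)
      + DD w (a+t) (b+t+t) (c+t) d
      + DD w (a+t) (b+t+t) c (d+t)
      + DD w a (b+t+t) (c+t) (d+t)
      + DD w (a+t) (b+t) (c+t+t) d
      + DD w (a+t) b (c+t+t) (d+t)
      + DD w a (b+t) (c+t+t) (d+t)
      + DD w (a+t) (b+t) c (d+t+t)
      + DD w (a+t) b (c+t) (d+t+t)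
      + DD w a (b+t) (c+t) (d+t+t)
      + 3 * DD w (a+t) (b+t) (c+t) (d+t)) * h2

lemma DD_zero {R : Type*} [CommRing R] (w : Fin 4 → R) (n : ℕ) (h : ∀ m, n ≤ m → gg w m = 0)
    (a b c d : ℕ) (hh : n ≤ a ∨ n ≤ b ∨ n ≤ c ∨ n ≤ d) : DD w a b c d = 0 := by
  have hu : ∀ m, n ≤ m → ∀ j, uu w m j = 0 := fun m hm j => h _ (by omega)
  rcases hh with hh | hh | hh | hh <;>
  · have := hu _ hh
    simp [DD, det4_eq, this]

lemma gg_zero {R : Type*} [CommRing R] (w : Fin 4 → R) (n : ℕ) (h : ∀ j < 4, gg w (n + j) = 0) :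
    ∀ m, n ≤ m → gg w m = 0 := by
  have : ∀ j, gg w (n + j) = 0 := by
    intro j
    induction j using Nat.strong_induction_on with
    | _ j ih =>
    by_cases hj : j < 4
    · exact h j hj
    · obtain ⟨i, rfl⟩ : ∃ i, j = i + 4 := ⟨j - 4, by omega⟩
      have e : n + (i + 4) = (n + i) + 4 := by omega
      rw [e, gg]
      have e1 := ih i (by omega)
      have e2 := ih (i+1) (by omega)
      have e3 := ih (i+2) (by omega)
      have e4 := ih (i+3) (by omega)
      rw [← add_assoc] at e2 e3 e4
      rw [e1, e2, e3, e4]; ring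
  intro m hm
  have := this (m - n)
  rwa [Nat.add_sub_cancel' hm] at this

lemma DD_pow {R : Type*} [CommRing R] [CharP R 2] (w : Fin 4 → R) (k j : ℕ) : ∀ a b c d,
    (∀ i1 i2 i3 i4, i1 + i2 + i3 + i4 = 2 * j →
      DD w (a + 2^k*i1) (b + 2^k*i2) (c+2^k*i3) (d+2^k*i4) = 0) →
    (w 1 ^ (2^k)) ^ j * DD w a b c d = 0 := by
  induction j with
  | zero =>
    intro a b c d h
    simpa using h 0 0 0 0 (by simp)
  | succ j ih =>
    intro a b c d h
    have key : ∀ a' b' c' d', (∃ i1 i2 i3 i4, i1 + i2 + i3 + i4 = 2 ∧ a' = a + 2^k*i1 ∧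
        b' = b + 2^k*i2 ∧ c' = c + 2^k*i3 ∧ d' = d + 2^k*i4) →
        (w 1 ^ (2^k)) ^ j * DD w a' b' c' d' = 0 := by
      rintro a' b' c' d' ⟨i1, i2, i3, i4, hi, rfl, rfl, rfl, rfl⟩
      apply ih
      intro j1 j2 j3 j4 hj
      have := h (i1+j1) (i2+j2) (i3+j3) (i4+j4) (by omega)
      simpa only [mul_add, add_assoc] using this
    rw [pow_succ, mul_assoc, DD_frob]
    simp only [mul_add]
    rw [key _ _ _ _ ⟨1,1,0,0, by simp⟩, key _ _ _ _ ⟨1,0,1,0, by simp⟩,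
      key _ _ _ _ ⟨1,0,0,1, by simp⟩, key _ _ _ _ ⟨0,1,1,0, by simp⟩,
      key _ _ _ _ ⟨0,1,0,1, by simp⟩, key _ _ _ _ ⟨0,0,1,1, by simp⟩]
    simp

section upper
variable {R : Type*} [CommRing R] [CharP R 2] (w : Fin 4 → R)

lemma upper_a (s n : ℕ) (hn : n ≤ 2 ^ s + 1) (h : ∀ m, n ≤ m → gg w m = 0) :
    w 1 ^ (2 ^ s) = 0 := by
  have := DD_frob w s 3 2 1 0
  rw [DD_base, mul_one] at this
  rw [this]
  have z := DD_zero w n h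
  rw [z, z, z, z, z, z] <;> first | omega | simp

lemma upper_b (t : ℕ) (h : ∀ m, 4 * 2 ^ t + 3 ≤ m → gg w m = 0) :
    w 1 ^ (8 * 2 ^ t - 3) = 0 := by
  have hb := DD_frob w 0 3 2 1 0
  rw [DD_base] at hb
  simp [DD_12, DD_23, DD_34] at hb
  have hp : 0 < 2 ^ t := by positivity
  have e : 8 * 2 ^ t - 3 = 2 ^ 2 * (2 * 2 ^ t - 1) + 1 := by omega
  rw [e, pow_succ, pow_mul]
  nth_rewrite 2 [hb]
  apply DD_pow
  intro i1 i2 i3 i4 hi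
  have z := DD_zero w _ h
  by_cases hz : 2 ^ t ≤ i1 ∨ 2 ^ t ≤ i2 ∨ 2 ^ t + 1 ≤ i3 ∨ 2 ^ t + 1 ≤ i4
  · apply z; omega
  · have : i1 + 1 = i4 := by omega
    subst this
    have : 0 + 2 ^ 2 * (i1 + 1) = 4 + 2 ^ 2 * i1 := by ring
    rw [this, DD_14]
end upper

lemma mem_of (n h : ℕ) (hn : 4 ≤ n)
    (H : ∀ (R : Type) [CommRing R] [CharP R 2] (w : Fin 4 → R),
      (∀ m, n ≤ m → gg w m = 0) → w 1 ^ h = 0) :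
    (X 1 : PP) ^ h ∈ borelIdeal n 4 := by
  rw [← Ideal.Quotient.eq_zero_iff_mem]
  rcases subsingleton_or_nontrivial (PP ⧸ borelIdeal n 4) with hs | hs
  · exact Subsingleton.elim _ _
  have : CharP (PP ⧸ borelIdeal n 4) 2 := by
    apply CharTwo.of_one_ne_zero_of_two_eq_zero one_ne_zero
    have : (2 : PP) = 0 := CharTwo.two_eq_zero
    rw [← map_ofNat (Ideal.Quotient.mk (borelIdeal n 4)) 2, this, map_zero]
  rw [map_pow]
  refine H _ (fun i => Ideal.Quotient.mk (borelIdeal n 4) (X i)) ?_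
  apply gg_zero
  intro j hj
  rw [← gg_map, Ideal.Quotient.eq_zero_iff_mem, borel_eq n hn]
  exact Ideal.subset_span ⟨j, hj, rfl⟩

/-! Lower bounds -/

noncomputable def vec4 (a b c d : ℕ) : Fin 4 →₀ ℕ := Finsupp.equivFunOnFinite.symm ![a, b, c, d]

noncomputable def cc (p : PP) (a b c d : ℕ) : ZMod 2 := coeff (vec4 a b c d) p

def sh0 (t : ℕ) (f : ℕ → ℕ → ℕ → ℕ → ZMod 2) (a b c d : ℕ) : ZMod 2 :=
  if t ≤ a then f (a - t) b c d else 0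
def sh1 (t : ℕ) (f : ℕ → ℕ → ℕ → ℕ → ZMod 2) (a b c d : ℕ) : ZMod 2 :=
  if t ≤ b then f a (b - t) c d else 0
def sh2 (t : ℕ) (f : ℕ → ℕ → ℕ → ℕ → ZMod 2) (a b c d : ℕ) : ZMod 2 :=
  if t ≤ c then f a b (c - t) d else 0
def sh3 (t : ℕ) (f : ℕ → ℕ → ℕ → ℕ → ZMod 2) (a b c d : ℕ) : ZMod 2 :=
  if t ≤ d then f a b c (d - t) else 0

lemma cc_X0 (t : ℕ) (p : PP) : cc (X 0 ^ t * p) = sh0 t (cc p) := by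
  funext a b c d
  unfold cc sh0
  rw [X_pow_eq_monomial, coeff_monomial_mul', one_mul]
  have : vec4 a b c d - Finsupp.single 0 t = vec4 (a - t) b c d := by
    ext i; fin_cases i <;> simp [vec4]
  rw [this]; simp [vec4, Finsupp.single_le_iff]

lemma cc_X1 (t : ℕ) (p : PP) : cc (X 1 ^ t * p) = sh1 t (cc p) := by
  funext a b c d
  unfold cc sh1
  rw [X_pow_eq_monomial, coeff_monomial_mul', one_mul]
  have : vec4 a b c d - Finsupp.single 1 t = vec4 a (b - t) c d := by
    ext i; fin_cases i <;> simp [vec4]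
  rw [this]; simp [vec4, Finsupp.single_le_iff]

lemma cc_X2 (t : ℕ) (p : PP) : cc (X 2 ^ t * p) = sh2 t (cc p) := by
  funext a b c d
  unfold cc sh2
  rw [X_pow_eq_monomial, coeff_monomial_mul', one_mul]
  have : vec4 a b c d - Finsupp.single 2 t = vec4 a b (c - t) d := by
    ext i; fin_cases i <;> simp [vec4]
  rw [this]; simp [vec4, Finsupp.single_le_iff]

lemma cc_X3 (t : ℕ) (p : PP) : cc (X 3 ^ t * p) = sh3 t (cc p) := by
  funext a b c d
  unfold cc sh3
  rw [X_pow_eq_monomial, coeff_monomial_mul', one_mul]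
  have : vec4 a b c d - Finsupp.single 3 t = vec4 a b c (d - t) := by
    ext i; fin_cases i <;> simp [vec4]
  rw [this]; simp [vec4, Finsupp.single_le_iff]

lemma cc_add (p q : PP) : cc (p + q) = fun a b c d => cc p a b c d + cc q a b c d := by
  funext a b c d; simp [cc]

lemma cc_sub (p q : PP) : cc (p - q) = fun a b c d => cc p a b c d - cc q a b c d := by
  funext a b c d; simp [cc]

lemma cc_one : cc 1 = fun a b c d => if a = 0 ∧ b = 0 ∧ c = 0 ∧ d = 0 then 1 else 0 := by
  funext a b c d
  unfold cc
  rw [coeff_one]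
  congr 1
  apply propext
  rw [eq_comm, Finsupp.ext_iff]
  simp [vec4, Fin.forall_fin_succ]

noncomputable def ee : PP := X 0 * X 1 + X 0 * X 2 + X 0 * X 3 + X 1 * X 2 + X 1 * X 3 + X 2 * X 3

noncomputable def Del : PP := (X 0 - X 1) * ((X 0 - X 2) * ((X 0 - X 3) * ((X 1 - X 2) *
  ((X 1 - X 3) * ((X 2 - X 3) * 1)))))

def opE (t : ℕ) (f : ℕ → ℕ → ℕ → ℕ → ZMod 2) (a b c d : ℕ) : ZMod 2 :=
  sh0 t (sh1 t f) a b c d + sh0 t (sh2 t f) a b c d + sh0 t (sh3 t f) a b c d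
    + sh1 t (sh2 t f) a b c d + sh1 t (sh3 t f) a b c d + sh2 t (sh3 t f) a b c d

lemma cc_ee (k : ℕ) (p : PP) : cc (ee ^ (2 ^ k) * p) = opE (2 ^ k) (cc p) := by
  have : ee ^ (2 ^ k) * p = X 0 ^ 2 ^ k * (X 1 ^ 2 ^ k * p) + X 0 ^ 2 ^ k * (X 2 ^ 2 ^ k * p)
      + X 0 ^ 2 ^ k * (X 3 ^ 2 ^ k * p) + X 1 ^ 2 ^ k * (X 2 ^ 2 ^ k * p)
      + X 1 ^ 2 ^ k * (X 3 ^ 2 ^ k * p) + X 2 ^ 2 ^ k * (X 3 ^ 2 ^ k * p) := by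
    unfold ee
    simp only [add_pow_char_pow, mul_pow]
    ring
  rw [this]
  simp only [cc_add, cc_X0, cc_X1, cc_X2, cc_X3]
  rfl

def cDel : ℕ → ℕ → ℕ → ℕ → ZMod 2 :=
  let f0 : ℕ → ℕ → ℕ → ℕ → ZMod 2 := fun a b c d => if a = 0 ∧ b = 0 ∧ c = 0 ∧ d = 0 then 1 else 0
  let f1 := fun a b c d => sh2 1 f0 a b c d - sh3 1 f0 a b c d
  let f2 := fun a b c d => sh1 1 f1 a b c d - sh3 1 f1 a b c d
  let f3 := fun a b c d => sh1 1 f2 a b c d - sh2 1 f2 a b c d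
  let f4 := fun a b c d => sh0 1 f3 a b c d - sh3 1 f3 a b c d
  let f5 := fun a b c d => sh0 1 f4 a b c d - sh2 1 f4 a b c d
  fun a b c d => sh0 1 f5 a b c d - sh1 1 f5 a b c d

lemma cc_Del : cc Del = cDel := by
  unfold Del
  have h0 : ∀ p : PP, cc (X 0 * p) = sh0 1 (cc p) := fun p => by rw [← cc_X0, pow_one]
  have h1 : ∀ p : PP, cc (X 1 * p) = sh1 1 (cc p) := fun p => by rw [← cc_X1, pow_one]
  have h2 : ∀ p : PP, cc (X 2 * p) = sh2 1 (cc p) := fun p => by rw [← cc_X2, pow_one]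
  have h3 : ∀ p : PP, cc (X 3 * p) = sh3 1 (cc p) := fun p => by rw [← cc_X3, pow_one]
  have key : ∀ (i j : Fin 4) (p : PP), (X i - X j) * p = X i * p - X j * p :=
    fun i j p => sub_mul _ _ _
  rw [key 0 1, cc_sub, h0, h1, key 0 2, cc_sub, h0, h2, key 0 3, cc_sub, h0, h3, key 1 2, cc_sub,
    h1, h2, key 1 3, cc_sub, h1, h3, key 2 3, cc_sub, h2, h3, cc_one]
  rfl

lemma base_B : cc Del 1 0 3 2 = 1 := by
  rw [cc_Del]; decide +kernel

lemma cc_base_A : cc (ee ^ 3 * Del) = opE 2 (opE 1 cDel) := by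
  have : ee ^ 3 * Del = ee ^ (2 ^ 1) * (ee ^ (2 ^ 0) * Del) := by ring
  rw [this, cc_ee, cc_ee, cc_Del]; rfl

lemma base_A1 : cc (ee ^ 3 * Del) 3 2 5 2 = 0 := by
  rw [cc_base_A]; decide +kernel
lemma base_A2 : cc (ee ^ 3 * Del) 3 6 1 2 = 1 := by
  rw [cc_base_A]; decide +kernel
lemma base_A3 : cc (ee ^ 3 * Del) 7 2 1 2 = 0 := by
  rw [cc_base_A]; decide +kernel

lemma pow_split (j c : ℕ) (hc : c ≤ 2 ^ j) :
    ee ^ (2 ^ (j+1) - c) * Del = ee ^ (2 ^ j) * (ee ^ (2 ^ j - c) * Del) := by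
  rw [← mul_assoc, ← pow_add]
  congr 2
  rw [pow_succ]; omega

lemma lem_B (j : ℕ) : cc (ee ^ (2 ^ (j+2) - 4) * Del) 1 0 (2 ^ (j+2) - 1) (2 ^ (j+2) - 2) = 1 := by
  induction j with
  | zero => simpa using base_B
  | succ j ih =>
    have hp : 0 < 2 ^ j := by positivity
    have e : 2 ^ (j+2) = 4 * 2 ^ j := by ring
    rw [show j + 1 + 2 = (j + 2) + 1 by ring, pow_split _ _ (by omega), cc_ee,
      pow_succ 2 (j+2)]
    rw [← ih]
    generalize cc (ee ^ (2 ^ (j+2) - 4) * Del) = f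
    generalize 2 ^ (j+2) = q at *
    simp only [opE, sh0, sh1, sh2, sh3]
    rw [if_neg (by omega), if_neg (by omega), if_neg (by omega), if_neg (by omega),
      if_neg (by omega), if_pos (by omega), if_pos (by omega)]
    simp only [zero_add]
    congr 1 <;> omega

lemma lem_L2 (j : ℕ) : cc (ee ^ (2 ^ (j+3) - 4) * Del)
    (2 ^ (j+2) + 1) (2 ^ (j+2)) (2 ^ (j+2) - 1) (2 ^ (j+2) - 2) = 1 := by
  have hp : 0 < 2 ^ j := by positivity
  have e : 2 ^ (j+2) = 4 * 2 ^ j := by ring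
  rw [show j + 3 = (j + 2) + 1 by ring, pow_split _ _ (by omega), cc_ee]
  rw [← lem_B j]
  generalize cc (ee ^ (2 ^ (j+2) - 4) * Del) = f
  generalize 2 ^ (j+2) = q at *
  have n1 : ¬ q ≤ q - 1 := by omega
  have n2 : ¬ q ≤ q - 2 := by omega
  simp [opE, sh0, sh1, sh2, sh3, n1, n2]

lemma lem_A (j : ℕ) :
    cc (ee ^ (2 ^ (j+2) - 1) * Del) 3 2 (2 ^ (j+2) + 1) (2 ^ (j+2) - 2) = 0 ∧
    cc (ee ^ (2 ^ (j+2) - 1) * Del) 3 (2 ^ (j+2) + 2) 1 (2 ^ (j+2) - 2) = 1 ∧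
    cc (ee ^ (2 ^ (j+2) - 1) * Del) (2 ^ (j+2) + 3) 2 1 (2 ^ (j+2) - 2) = 0 := by
  induction j with
  | zero => exact ⟨base_A1, base_A2, base_A3⟩
  | succ j ih =>
    have hp : 0 < 2 ^ j := by positivity
    have e : 2 ^ (j+2) = 4 * 2 ^ j := by ring
    rw [show j + 1 + 2 = (j + 2) + 1 by ring, pow_split _ _ (by omega), cc_ee,
      pow_succ 2 (j+2)]
    generalize cc (ee ^ (2 ^ (j+2) - 1) * Del) = f at *
    generalize 2 ^ (j+2) = q at *
    have n1 : ¬ q ≤ 3 := by omega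
    have n2 : ¬ q ≤ 2 := by omega
    have n3 : ¬ q ≤ 1 := by omega
    have p1 : q ≤ q * 2 - 2 := by omega
    have p2 : q ≤ q * 2 + 1 := by omega
    have p3 : q ≤ q * 2 + 2 := by omega
    have p4 : q ≤ q * 2 + 3 := by omega
    have q1 : q * 2 - 2 - q = q - 2 := by omega
    have q2 : q * 2 + 1 - q = q + 1 := by omega
    have q3 : q * 2 + 2 - q = q + 2 := by omega
    have q4 : q * 2 + 3 - q = q + 3 := by omega
    simp only [opE, sh0, sh1, sh2, sh3, n1, n2, n3, p1, p2, p3, p4, q1, q2, q3, q4, if_true,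
      if_false, zero_add, add_zero, ite_self]
    exact ih
    
lemma lem_L1 (j : ℕ) : cc (ee ^ (2 ^ (j+3) - 1) * Del)
    (2 ^ (j+2) + 3) (2 ^ (j+2) + 2) (2 ^ (j+2) + 1) (2 ^ (j+2) - 2) = 1 := by
  have hp : 0 < 2 ^ j := by positivity
  have e : 2 ^ (j+2) = 4 * 2 ^ j := by ring
  have ih := lem_A j
  rw [show j + 3 = (j + 2) + 1 by ring, pow_split _ _ (by omega), cc_ee]
  generalize cc (ee ^ (2 ^ (j+2) - 1) * Del) = f at *
  generalize 2 ^ (j+2) = q at *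
  have n2 : ¬ q ≤ q - 2 := by omega
  simp [opE, sh0, sh1, sh2, sh3, n2, ih]

lemma gg_alt {R : Type*} [CommRing R] (x y z t : R) : ∀ m,
    gg ![x + y + z + t, -(x*y + x*z + x*t + y*z + y*t + z*t),
      x*y*z + x*y*t + x*z*t + y*z*t, -(x*y*z*t)] m *
      ((x - y) * ((x - z) * ((x - t) * ((y - z) * ((y - t) * ((z - t) * 1)))))) =
    x ^ m * ((y - z) * (y - t) * (z - t)) - y ^ m * ((x - z) * (x - t) * (z - t))
     + z ^ m * ((x - y) * (x - t) * (y - t)) - t ^ m * ((x - y) * (x - z) * (y - z))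
  | 0 => by simp only [gg]; ring
  | 1 => by simp only [gg]; ring
  | 2 => by simp only [gg]; ring
  | 3 => by simp only [gg]; ring
  | (m+4) => by
    have e3 := gg_alt x y z t (m+3)
    have e2 := gg_alt x y z t (m+2)
    have e1 := gg_alt x y z t (m+1)
    have e0 := gg_alt x y z t m
    rw [gg]
    generalize gg (R := R) _ (m+3) = g3 at *
    generalize gg (R := R) _ (m+2) = g2 at *
    generalize gg (R := R) _ (m+1) = g1 at *
    generalize gg (R := R) _ m = g0 at *
    simp only [Matrix.cons_val]
    linear_combination (x + y + z + t) * e3 - (x*y + x*z + x*t + y*z + y*t + z*t) * e2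
      + (x*y*z + x*y*t + x*z*t + y*z*t) * e1 - (x*y*z*t) * e0

noncomputable def phi : PP →ₐ[ZMod 2] PP :=
  aeval ![X 0 + X 1 + X 2 + X 3, -(X 0*X 1 + X 0*X 2 + X 0*X 3 + X 1*X 2 + X 1*X 3 + X 2*X 3),
      X 0*X 1*X 2 + X 0*X 1*X 3 + X 0*X 2*X 3 + X 1*X 2*X 3, -(X 0*X 1*X 2*X 3)]

lemma phi_gg (m : ℕ) : phi (gg X m) * Del =
    X 0 ^ m * ((X 1 - X 2) * (X 1 - X 3) * (X 2 - X 3))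
     - X 1 ^ m * ((X 0 - X 2) * (X 0 - X 3) * (X 2 - X 3))
     + X 2 ^ m * ((X 0 - X 1) * (X 0 - X 3) * (X 1 - X 3))
     - X 3 ^ m * ((X 0 - X 1) * (X 0 - X 2) * (X 1 - X 2)) := by
  rw [← gg_alt (X 0 : PP) (X 1) (X 2) (X 3) m]
  have h := gg_map (phi : PP →+* PP) X m
  have e : phi (gg X m) = (phi : PP →+* PP) (gg X m) := rfl
  rw [e, h]
  unfold Del
  congr 2
  funext i
  simp [phi]

lemma phi_vanish (n : ℕ) (hn : 4 ≤ n) (f : PP) (hf : f ∈ borelIdeal n 4)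
    (a b c d : ℕ) (ha : a < n) (hb : b < n) (hc : c < n) (hd : d < n) :
    ∀ r : PP, cc (r * (phi f * Del)) a b c d = 0 := by
  rw [borel_eq n hn] at hf
  induction hf using Submodule.span_induction with
  | zero => intro r; simp [cc]
  | add p q _ _ hp hq => intro r; rw [map_add, add_mul, mul_add, cc_add]; simp [hp, hq]
  | mem p hp =>
    intro r
    obtain ⟨j, hj, rfl⟩ := hp
    rw [phi_gg]
    simp only [mul_add, mul_sub r, mul_left_comm r, cc_add, cc_sub, cc_X0, cc_X1, cc_X2, cc_X3]
    simp only [sh0, sh1, sh2, sh3]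
    rw [if_neg (by omega), if_neg (by omega), if_neg (by omega), if_neg (by omega)]
    simp
  | smul q p _ hp =>
    intro r
    rw [smul_eq_mul, map_mul, mul_assoc, ← mul_assoc]
    exact hp _

lemma not_mem_of (n h : ℕ) (hn : 4 ≤ n) (a b c d : ℕ) (ha : a < n) (hb : b < n) (hc : c < n)
    (hd : d < n) (hh : cc (ee ^ h * Del) a b c d = 1) : (X 1 : PP) ^ h ∉ borelIdeal n 4 := by
  intro hm
  have := phi_vanish n hn _ hm a b c d ha hb hc hd 1
  have e : phi (X 1) = ee := by
    have h2 : (2 : PP) = 0 := CharTwo.two_eq_zero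
    simp only [phi, aeval_X, ee, Matrix.cons_val]
    linear_combination (-(X 0 * X 1 + X 0 * X 2 + X 0 * X 3 + X 1 * X 2 + X 1 * X 3 + X 2 * X 3)) * h2
  rw [one_mul, map_pow, e, hh] at this
  exact one_ne_zero this

lemma lower_1 (n s : ℕ) (hs : 2 ≤ s) (hn : 2 ^ s + 4 ≤ n) :
    (X 1 : PP) ^ (2 ^ (s + 1) - 1) ∉ borelIdeal n 4 := by
  obtain ⟨j, rfl⟩ := Nat.exists_eq_add_of_le' hs
  have hp : 0 < 2 ^ (j+2) := by positivity
  exact not_mem_of n _ (by omega) _ _ _ _ (by omega) (by omega) (by omega) (by omega) (lem_L1 j)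

lemma lower_2 (n s : ℕ) (hs : 2 ≤ s) (hn : 2 ^ s + 2 ≤ n) :
    (X 1 : PP) ^ (2 ^ (s + 1) - 4) ∉ borelIdeal n 4 := by
  obtain ⟨j, rfl⟩ := Nat.exists_eq_add_of_le' hs
  have e : 2 ^ (j+2) = 4 * 2 ^ j := by ring
  have hp : 0 < 2 ^ j := by positivity
  exact not_mem_of n _ (by omega) _ _ _ _ (by omega) (by omega) (by omega) (by omega) (lem_L2 j)

lemma upper_2 (n s : ℕ) (hs : 2 ≤ s) (hn' : 4 ≤ n) (hn : n ≤ 2 ^ s + 3) :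
    (X 1 : PP) ^ (2 ^ (s + 1) - 4 + 1) ∈ borelIdeal n 4 := by
  obtain ⟨j, rfl⟩ := Nat.exists_eq_add_of_le' hs
  have e : 2 ^ (j+2) = 4 * 2 ^ j := by ring
  have e' : 2 ^ (j+2+1) = 8 * 2 ^ j := by ring
  have hp : 0 < 2 ^ j := by positivity
  apply mem_of n _ hn'
  intro R _ _ w h
  have := upper_b w j (fun m hm => h m (by omega))
  rw [e', show 8 * 2 ^ j - 4 + 1 = 8 * 2 ^ j - 3 by omega]
  exact this

lemma upper_1 (n s : ℕ) (hn' : 4 ≤ n) (hn : n ≤ 2 ^ s + 1) :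
    (X 1 : PP) ^ (2 ^ s - 1 + 1) ∈ borelIdeal n 4 := by
  apply mem_of n _ hn'
  intro R _ _ w h
  have hp : 0 < 2 ^ s := by positivity
  rw [show 2 ^ s - 1 + 1 = 2 ^ s by omega]
  exact upper_a w s n hn h

/-- Lemma F (Dutta–Khare) for `k = 4`: the height of `w₂` in
`H*(G_{n,4}; Z₂) = (ZMod 2)[w₁,…,w₄]/I_{n,4}` is `2^s − 1` if `n = 2^s + 1` (`s ≥ 3`),
`2^(s+1) − 4` if `n = 2^s + 2` or `n = 2^s + 3` (`s ≥ 3`), and `2^(s+1) − 1` if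
`2^s + 4 ≤ n ≤ 2^(s+1)`. -/
theorem height_w2_G_n_4 (n h : ℕ) (hn : 8 ≤ n)
    (hcase :
      (∃ s, 3 ≤ s ∧ n = 2 ^ s + 1 ∧ h = 2 ^ s - 1) ∨
      (∃ s, 3 ≤ s ∧ n = 2 ^ s + 2 ∧ h = 2 ^ (s + 1) - 4) ∨
      (∃ s, 3 ≤ s ∧ n = 2 ^ s + 3 ∧ h = 2 ^ (s + 1) - 4) ∨
      (∃ s, 2 ^ s + 4 ≤ n ∧ n ≤ 2 ^ (s + 1) ∧ h = 2 ^ (s + 1) - 1)) :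
    (X 1 : MvPolynomial (Fin 4) (ZMod 2)) ^ h ∉ borelIdeal n 4 ∧
    (X 1 : MvPolynomial (Fin 4) (ZMod 2)) ^ (h + 1) ∈ borelIdeal n 4 := by
  rcases hcase with ⟨s, hs, rfl, rfl⟩ | ⟨s, hs, rfl, rfl⟩ | ⟨s, hs, rfl, rfl⟩ | ⟨s, h1, h2, rfl⟩
  · refine ⟨?_, upper_1 _ _ (by omega) le_rfl⟩
    obtain ⟨t, rfl⟩ := Nat.exists_eq_add_of_le' hs
    have e : 2 ^ (t+3) = 2 ^ (t+2) + 4 * 2 ^ t := by ring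
    have hp : 0 < 2 ^ t := by positivity
    exact lower_1 _ (t+2) (by omega) (by omega)
  · exact ⟨lower_2 _ s (by omega) le_rfl, upper_2 _ s (by omega) (by omega) (by omega)⟩
  · exact ⟨lower_2 _ s (by omega) (by omega), upper_2 _ s (by omega) (by omega) (by omega)⟩
  · refine ⟨lower_1 _ s ?_ h1, upper_1 _ _ (by omega) (by omega)⟩
    by_contra hs
    have : s + 1 ≤ 2 := by omega
    have : 2 ^ (s+1) ≤ 2 ^ 2 := Nat.pow_le_pow_right (by norm_num) this
    omega
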